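/- Let u₁, u₂ ∈ C²(ℝ⁴₊) ∩ H¹(ℝ⁴₊) be nonnegative solutions of the system -Δu₁ + λ₁u₁ = μ₁u₁³ + α₁u₁^{p-1} + βu₂²u₁ and -Δu₂ + λ₂u₂ = μ₂u₂³ + α₂u₂^{p-1} + βu₁²u₂ on the half-space ℝ⁴₊ = {x ∈ ℝ⁴ : x₄ > 0}, with u₁ = u₂ = 0 on ∂ℝ⁴₊, u₁, u₂ → 0 as |x| → ∞, and suitable decay of derivatives. If (u₁, u₂) ≢ (0,0), then multiplying the system by (∂u₁/∂x₄, ∂u₂/∂x₄) and integrating by parts yields 0 = ½∫_{∂ℝ⁴₊} (|∂u₁/∂x₄|² + |∂u₂/∂x₄|²) ds > 0, a contradiction; hence u₁ ≡ 0 and u₂ ≡ 0. -/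

import Mathlib

open MeasureTheory Filter

/-- The Laplacian of `u : ℝ⁴ → ℝ` as the sum of the pure second partial derivatives. -/
noncomputable def lap4 (u : EuclideanSpace ℝ (Fin 4) → ℝ)
    (x : EuclideanSpace ℝ (Fin 4)) : ℝ :=
  ∑ i : Fin 4,
    fderiv ℝ (fun y => fderiv ℝ u y (EuclideanSpace.single i 1)) x
      (EuclideanSpace.single i 1)

namespace HS

/-- partial derivative -/
noncomputable def D (i : Fin 4) (v : (Fin 4 → ℝ) → ℝ) (x : Fin 4 → ℝ) : ℝ :=
  fderiv ℝ v x (Pi.single i 1)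

lemma D_mul (i : Fin 4) {f g : (Fin 4 → ℝ) → ℝ} (x : Fin 4 → ℝ)
    (hf : DifferentiableAt ℝ f x) (hg : DifferentiableAt ℝ g x) :
    D i (fun y => f y * g y) x = f x * D i g x + D i f x * g x := by
  unfold D
  rw [fderiv_fun_mul hf hg]
  simp [mul_comm]

lemma D_add (i : Fin 4) {f g : (Fin 4 → ℝ) → ℝ} (x : Fin 4 → ℝ)
    (hf : DifferentiableAt ℝ f x) (hg : DifferentiableAt ℝ g x) :
    D i (fun y => f y + g y) x = D i f x + D i g x := by
  unfold D
  rw [fderiv_fun_add hf hg]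
  simp

lemma D_sub (i : Fin 4) {f g : (Fin 4 → ℝ) → ℝ} (x : Fin 4 → ℝ)
    (hf : DifferentiableAt ℝ f x) (hg : DifferentiableAt ℝ g x) :
    D i (fun y => f y - g y) x = D i f x - D i g x := by
  unfold D
  rw [fderiv_fun_sub hf hg]
  simp

lemma D_cmul (i : Fin 4) {f : (Fin 4 → ℝ) → ℝ} (c : ℝ) (x : Fin 4 → ℝ)
    (hf : DifferentiableAt ℝ f x) :
    D i (fun y => c * f y) x = c * D i f x := by
  rw [D_mul i x (by fun_prop) hf]
  simp [D]

lemma D_comp (i : Fin 4) {f : (Fin 4 → ℝ) → ℝ} {h : ℝ → ℝ} {h' : ℝ} (x : Fin 4 → ℝ)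
    (hf : DifferentiableAt ℝ f x) (hh : HasDerivAt h h' (f x)) :
    D i (fun y => h (f y)) x = h' * D i f x := by
  unfold D
  have := (hh.comp_hasFDerivAt x hf.hasFDerivAt).fderiv
  rw [show (fun y => h (f y)) = h ∘ f from rfl, this]
  simp

lemma D_contDiff (i : Fin 4) {v : (Fin 4 → ℝ) → ℝ} (hv : ContDiff ℝ 2 v) :
    ContDiff ℝ 1 (D i v) := by
  unfold D
  exact (hv.fderiv_right (m := 1) (by norm_num)).clm_apply contDiff_const

lemma D_cont (i : Fin 4) {v : (Fin 4 → ℝ) → ℝ} (hv : ContDiff ℝ 1 v) :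
    Continuous (D i v) := by
  unfold D
  exact (hv.continuous_fderiv (by norm_num)).clm_apply continuous_const

lemma D_symm (i j : Fin 4) {v : (Fin 4 → ℝ) → ℝ} (hv : ContDiff ℝ 2 v) (x : Fin 4 → ℝ) :
    D i (D j v) x = D j (D i v) x := by
  have hd : DifferentiableAt ℝ (fderiv ℝ v) x :=
    ((hv.fderiv_right (m := 1) (by norm_num)).differentiable (by norm_num)) x
  have key : ∀ a b : Fin 4, D a (D b v) x
      = fderiv ℝ (fderiv ℝ v) x (Pi.single a 1) (Pi.single b 1) := by
    intro a b
    have : D a (D b v) x =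
      fderiv ℝ (fun y => fderiv ℝ v y (Pi.single b 1)) x (Pi.single a 1) := rfl
    rw [this, fderiv_clm_apply hd (by fun_prop)]
    simp
  rw [key, key]
  exact (hv.contDiffAt.isSymmSndFDerivAt (by simp)).eq _ _

/-- product functions -/
noncomputable def P (h : Fin 4 → ℝ → ℝ) (x : Fin 4 → ℝ) : ℝ := ∏ j, h j (x j)

lemma D_P (i : Fin 4) (h : Fin 4 → ℝ → ℝ) (h' : ℝ → ℝ)
    (hd : ∀ j, Differentiable ℝ (h j)) (hi : ∀ t, HasDerivAt (h i) (h' t) t) :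
    D i (P h) = P (Function.update h i h') := by
  funext x
  have h1 : HasFDerivAt (P h) _ x := HasFDerivAt.finsetProd (u := Finset.univ)
    (g := fun j (x : Fin 4 → ℝ) => h j (x j))
    (g' := fun j => deriv (h j) (x j) • (ContinuousLinearMap.proj j : (Fin 4 → ℝ) →L[ℝ] ℝ))
    (fun j _ => ((hd j (x j)).hasDerivAt.comp_hasFDerivAt x (hasFDerivAt_apply j x)))
  unfold D
  rw [h1.fderiv]
  simp only [P, _root_.sum_apply, _root_.smul_apply,
    ContinuousLinearMap.proj_apply, smul_eq_mul]
  rw [Finset.sum_eq_single i]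
  · rw [← Finset.mul_prod_erase Finset.univ _ (Finset.mem_univ i)]
    simp only [Function.update_self, Pi.single_eq_same, (hi _).deriv, mul_one]
    rw [mul_comm]
    congr 1
    apply Finset.prod_congr rfl
    intro j hj
    rw [Function.update_of_ne (Finset.ne_of_mem_erase hj)]
  · intro j _ hj
    simp [Pi.single_eq_of_ne hj]
  · simp

lemma P_contDiff (h : Fin 4 → ℝ → ℝ) (n : ℕ∞) (hh : ∀ j, ContDiff ℝ n (h j)) :
    ContDiff ℝ n (P h) := by
  unfold P
  exact contDiff_prod fun j _ => (hh j).comp (contDiff_apply ℝ ℝ j)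

/-- divergence theorem -/
lemma diverg (a b : Fin 4 → ℝ) (hab : a ≤ b) (f : Fin 4 → (Fin 4 → ℝ) → ℝ)
    (hf : ∀ i, ContDiff ℝ 1 (f i)) :
    ∫ x in Set.pi Set.univ (fun i => Set.Ioo (a i) (b i)), ∑ i, D i (f i) x =
      ∑ i : Fin 4, ((∫ y in Set.Icc (a ∘ i.succAbove) (b ∘ i.succAbove),
          f i (i.insertNth (b i) y)) -
        ∫ y in Set.Icc (a ∘ i.succAbove) (b ∘ i.succAbove), f i (i.insertNth (a i) y)) := by
  have h := integral_divergence_of_hasFDerivAt_off_countable' a b hab f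
    (fun i x => fderiv ℝ (f i) x) ∅ Set.countable_empty
    (fun i => (hf i).continuous.continuousOn)
    (fun x _ i => ((hf i).differentiable (by norm_num) x).hasFDerivAt)
    (by
      have : Continuous (fun x => ∑ i, D i (f i) x) :=
        continuous_finsetSum _ fun i _ => D_cont i (hf i)
      exact this.continuousOn.integrableOn_compact isCompact_Icc)
  rw [← h, volume_pi, setIntegral_congr_set Measure.univ_pi_Ioo_ae_eq_Icc]
  rfl

lemma zero_of_int {n : ℕ} (U : Set (Fin n → ℝ)) (hU : IsOpen U) (g : (Fin n → ℝ) → ℝ)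
    (hg : Continuous g) (hi : IntegrableOn g U)
    (h0 : ∀ x ∈ U, 0 ≤ g x) (hle : ∫ x in U, g x ≤ 0) : ∀ x ∈ U, g x = 0 := by
  have h0' : 0 ≤ᵐ[volume.restrict U] g := by
    filter_upwards [ae_restrict_mem hU.measurableSet] with x hx using h0 x hx
  have h1 : ∫ x in U, g x = 0 := le_antisymm hle (integral_nonneg_of_ae h0')
  have h2 := (integral_eq_zero_iff_of_nonneg_ae h0' hi).1 h1
  exact Measure.eqOn_open_of_ae_eq h2 hU hg.continuousOn continuousOn_const

lemma box_int {n : ℕ} (a b : Fin n → ℝ) (g : (Fin n → ℝ) → ℝ) (hg : Continuous g) :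
    IntegrableOn g (Set.pi Set.univ (fun i => Set.Ioo (a i) (b i))) := by
  apply (hg.continuousOn.integrableOn_compact (isCompact_Icc (a := a) (b := b))).mono_set
  intro x hx
  exact ⟨fun i => (hx i trivial).1.le, fun i => (hx i trivial).2.le⟩

lemma P_nonneg (h : Fin 4 → ℝ → ℝ) (z : Fin 4 → ℝ) (hz : ∀ j, 0 ≤ h j (z j)) : 0 ≤ P h z :=
  Finset.prod_nonneg fun j _ => hz j

lemma P_update (h : Fin 4 → ℝ → ℝ) (i : Fin 4) (g : ℝ → ℝ) (z : Fin 4 → ℝ) :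
    P (Function.update h i g) z = g (z i) * ∏ j ∈ Finset.univ.erase i, h j (z j) := by
  unfold P
  rw [← Finset.mul_prod_erase Finset.univ _ (Finset.mem_univ i)]
  simp only [Function.update_self]
  congr 1
  apply Finset.prod_congr rfl
  intro j hj
  rw [Function.update_of_ne (Finset.ne_of_mem_erase hj)]

lemma step2_aux (a b : Fin 4 → ℝ) (hab : ∀ i, a i < b i) (ha3 : a 3 = 0)
    (h h' : Fin 4 → ℝ → ℝ) (s : Fin 4 → ℝ)
    (hsm : ∀ j, ContDiff ℝ 2 (h j)) (hsm' : ∀ j, ContDiff ℝ 2 (h' j))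
    (hd : ∀ j t, HasDerivAt (h j) (h' j t) t)
    (hd' : ∀ j t, HasDerivAt (h' j) (s j * h j t) t)
    (hpos : ∀ j t, a j ≤ t → t ≤ b j → 0 ≤ h j t)
    (hpos' : ∀ j t, a j < t → t < b j → 0 < h j t)
    (hb0 : ∀ j, h j (b j) = 0) (hb1 : ∀ j, h' j (b j) ≤ 0)
    (ha0 : ∀ j, j ≠ 3 → h j (a j) = 0) (ha1 : ∀ j, j ≠ 3 → 0 ≤ h' j (a j))
    (v : (Fin 4 → ℝ) → ℝ) (hv : ContDiff ℝ 2 v)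
    (hv0 : ∀ x, 0 ≤ x 3 → 0 ≤ v x) (hvb : ∀ x, x 3 = 0 → v x = 0)
    (hvb' : ∀ x, x 3 = 0 → D 3 v x = 0)
    (hle : ∀ x ∈ Set.pi Set.univ (fun i => Set.Ioo (a i) (b i)),
      ∑ i, D i (D i v) x ≤ (∑ i, s i - 1) * v x) :
    ∀ x ∈ Set.pi Set.univ (fun i => Set.Ioo (a i) (b i)), v x = 0 := by
  have hdiff : ∀ j, Differentiable ℝ (h j) := fun j t => (hd j t).differentiableAt
  have hDP : ∀ i, D i (P h) = P (Function.update h i (h' i)) := fun i =>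
    D_P i h (h' i) hdiff (hd i)
  have hPs : ContDiff ℝ 2 (P h) := P_contDiff h 2 hsm
  have hDPs : ∀ i, ContDiff ℝ 2 (D i (P h)) := by
    intro i
    rw [hDP]
    apply P_contDiff _ 2
    intro j
    by_cases hj : j = i
    · subst hj; simpa using hsm' j
    · simpa [Function.update_of_ne hj] using hsm j
  have hDDP : ∀ i x, D i (D i (P h)) x = s i * P h x := by
    intro i x
    rw [hDP, D_P i _ (fun t => s i * h i t)]
    · rw [Function.update_idem, P_update, P, ← Finset.mul_prod_erase Finset.univ _ (Finset.mem_univ i)]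
      ring
    · intro j
      by_cases hj : j = i
      · subst hj
        intro t
        simpa using (hd' j t).differentiableAt
      · simpa [Function.update_of_ne hj] using hdiff j
    · intro t
      simpa using hd' i t
  set B := Set.pi Set.univ (fun i => Set.Ioo (a i) (b i)) with hB
  have hBo : IsOpen B := isOpen_set_pi Set.finite_univ fun i _ => isOpen_Ioo
  let f : Fin 4 → (Fin 4 → ℝ) → ℝ := fun i x => P h x * D i v x - v x * D i (P h) x
  have hv1 : ContDiff ℝ 1 v := hv.of_le (by norm_num)
  have hP1 : ContDiff ℝ 1 (P h) := hPs.of_le (by norm_num)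
  have hf : ∀ i, ContDiff ℝ 1 (f i) := fun i =>
    (hP1.mul (D_contDiff i hv)).sub (hv1.mul (D_contDiff i hPs))
  have hdiv : ∀ x, ∑ i, D i (f i) x = P h x * (∑ i, D i (D i v) x - (∑ i, s i) * v x) := by
    intro x
    have : ∀ i, D i (f i) x = P h x * (D i (D i v) x - s i * v x) := by
      intro i
      have e1 := hP1.differentiable (by norm_num) x
      have e2 := hv1.differentiable (by norm_num) x
      have e3 := (D_contDiff i hv).differentiable (by norm_num) x
      have e4 := (D_contDiff i hPs).differentiable (by norm_num) x
      show D i (fun y => P h y * D i v y - v y * D i (P h) y) x = _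
      rw [D_sub i x (e1.fun_mul e3) (e2.fun_mul e4), D_mul i x e1 e3, D_mul i x e2 e4, hDDP]
      ring
    simp only [this]
    rw [← Finset.mul_sum, Finset.sum_sub_distrib, Finset.sum_mul]
  have hmain := diverg a b (fun i => (hab i).le) f hf
  have hprod : ∀ i, ∀ z ∈ Set.Icc a b, 0 ≤ ∏ j ∈ Finset.univ.erase i, h j (z j) := by
    intro i z hz
    exact Finset.prod_nonneg fun j _ => hpos j _ (hz.1 j) (hz.2 j)
  have hP0 : ∀ i (z : Fin 4 → ℝ), h i (z i) = 0 → P h z = 0 := fun i z hz =>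
    Finset.prod_eq_zero (Finset.mem_univ i) hz
  have hvz : ∀ z ∈ Set.Icc a b, 0 ≤ v z := fun z hz => hv0 z (by have := hz.1 3; rwa [ha3] at this)
  have hrhs : 0 ≤ ∑ i : Fin 4, ((∫ y in Set.Icc (a ∘ i.succAbove) (b ∘ i.succAbove),
          f i (i.insertNth (b i) y)) -
        ∫ y in Set.Icc (a ∘ i.succAbove) (b ∘ i.succAbove), f i (i.insertNth (a i) y)) := by
    apply Finset.sum_nonneg
    intro i _
    have hfr : 0 ≤ ∫ y in Set.Icc (a ∘ i.succAbove) (b ∘ i.succAbove),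
          f i (i.insertNth (b i) y) := by
      apply setIntegral_nonneg measurableSet_Icc
      intro y hy
      have hz : (i.insertNth (b i) y : Fin 4 → ℝ) ∈ Set.Icc a b :=
        Fin.insertNth_mem_Icc.2 ⟨⟨(hab i).le, le_rfl⟩, hy⟩
      have hzi : (i.insertNth (b i) y : Fin 4 → ℝ) i = b i := by simp
      generalize (i.insertNth (b i) y : Fin 4 → ℝ) = z at hz hzi
      show 0 ≤ P h z * D i v z - v z * D i (P h) z
      rw [hP0 i z (by rw [hzi, hb0]), hDP, P_update, hzi]
      have := mul_nonneg (hvz z hz) (mul_nonneg (neg_nonneg.2 (hb1 i)) (hprod i z hz))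
      linarith
    have hbk : ∫ y in Set.Icc (a ∘ i.succAbove) (b ∘ i.succAbove),
          f i (i.insertNth (a i) y) ≤ 0 := by
      apply setIntegral_nonpos measurableSet_Icc
      intro y hy
      have hz : (i.insertNth (a i) y : Fin 4 → ℝ) ∈ Set.Icc a b :=
        Fin.insertNth_mem_Icc.2 ⟨⟨le_rfl, (hab i).le⟩, hy⟩
      have hzi : (i.insertNth (a i) y : Fin 4 → ℝ) i = a i := by simp
      generalize (i.insertNth (a i) y : Fin 4 → ℝ) = z at hz hzi
      show P h z * D i v z - v z * D i (P h) z ≤ 0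
      by_cases hi : i = 3
      · subst hi
        rw [hvb z (hzi.trans ha3), hvb' z (hzi.trans ha3)]
        simp
      · rw [hP0 i z (by rw [hzi, ha0 i hi]), hDP, P_update, hzi]
        have := mul_nonneg (hvz z hz) (mul_nonneg (ha1 i hi) (hprod i z hz))
        linarith
    linarith
  rw [← hmain] at hrhs
  have hPv : Continuous (fun x => P h x * v x) := hPs.continuous.mul hv.continuous
  have hBI : ∀ x ∈ B, x ∈ Set.Icc a b := fun x hx =>
    ⟨fun i => (hx i trivial).1.le, fun i => (hx i trivial).2.le⟩
  have hPB : ∀ x ∈ B, 0 < P h x := fun x hx =>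
    Finset.prod_pos fun j _ => hpos' j _ (hx j trivial).1 (hx j trivial).2
  have hint : ∫ x in B, P h x * v x ≤ 0 := by
    have hcont : Continuous (fun x => ∑ i, D i (f i) x) :=
      continuous_finsetSum _ fun i _ => D_cont i (hf i)
    have : ∫ x in B, ∑ i, D i (f i) x ≤ ∫ x in B, -(P h x * v x) := by
      apply setIntegral_mono_on (box_int a b _ hcont) (box_int a b _ hPv.neg) hBo.measurableSet
      intro x hx
      rw [hdiv]
      show _ ≤ -(P h x * v x)
      have := mul_le_mul_of_nonneg_left (hle x hx) (hPB x hx).le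
      linarith
    rw [integral_neg] at this
    linarith
  intro x hx
  have := zero_of_int B hBo _ hPv (box_int a b _ hPv)
    (fun x hx => mul_nonneg (hPB x hx).le (hvz x (hBI x hx))) hint x hx
  exact (mul_eq_zero.1 this).resolve_left (hPB x hx).ne'

lemma step2 (v w : (Fin 4 → ℝ) → ℝ) (hv : ContDiff ℝ 2 v) (hw : Continuous w)
    (hv0 : ∀ x, 0 ≤ x 3 → 0 ≤ v x) (hvb : ∀ x, x 3 = 0 → v x = 0)
    (hvb' : ∀ x, x 3 = 0 → D 3 v x = 0)
    (hle : ∀ x, 0 < x 3 → ∑ i, D i (D i v) x ≤ w x * v x) :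
    ∀ x, 0 < x 3 → v x = 0 := by
  intro c hc
  let L : ℝ := c 3 + 1
  let a : Fin 4 → ℝ := fun j => if j = 3 then 0 else c j - Real.pi / 2
  let b : Fin 4 → ℝ := fun j => if j = 3 then L else c j + Real.pi / 2
  have hpi := Real.pi_pos
  have hL : 0 < L := by simp only [L]; linarith
  obtain ⟨C, hC⟩ := (isCompact_Icc (a := a) (b := b)).bddAbove_image hw.continuousOn
  have hC' : ∀ x ∈ Set.Icc a b, w x ≤ C := fun x hx => hC ⟨x, hx, rfl⟩
  let k : ℝ := |C| + 4
  have hk : 0 < k := by positivity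
  have hkC : C ≤ k ^ 2 - 4 := by
    have := le_abs_self C
    have := abs_nonneg C
    simp only [k]; nlinarith
  have hsh : ∀ t, HasDerivAt (fun t => Real.sinh (k * (L - t)))
      (-k * Real.cosh (k * (L - t))) t := by
    intro t
    have h1 : HasDerivAt (fun t : ℝ => k * (L - t)) (k * (-1)) t :=
      ((hasDerivAt_id t).const_sub L).const_mul k
    convert! h1.sinh using 1
    ring
  have hch : ∀ t, HasDerivAt (fun t => -k * Real.cosh (k * (L - t)))
      (k ^ 2 * Real.sinh (k * (L - t))) t := by
    intro t
    have h1 : HasDerivAt (fun t : ℝ => k * (L - t)) (k * (-1)) t :=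
      ((hasDerivAt_id t).const_sub L).const_mul k
    convert! h1.cosh.const_mul (-k) using 1
    ring
  have hcs : ∀ d t : ℝ, HasDerivAt (fun t => Real.cos (t - d)) (-Real.sin (t - d)) t := by
    intro d t
    convert! ((hasDerivAt_id t).sub_const d).cos using 1
    simp
  have hsn : ∀ d t : ℝ, HasDerivAt (fun t => -Real.sin (t - d)) (-1 * Real.cos (t - d)) t := by
    intro d t
    convert! ((hasDerivAt_id t).sub_const d).sin.neg using 1
    simp
  refine step2_aux a b ?_ (by simp [a])
    (fun j t => if j = 3 then Real.sinh (k * (L - t)) else Real.cos (t - c j))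
    (fun j t => if j = 3 then -k * Real.cosh (k * (L - t)) else -Real.sin (t - c j))
    (fun j => if j = 3 then k ^ 2 else -1)
    ?_ ?_ ?_ ?_ ?_ ?_ ?_ ?_ ?_ ?_ v hv hv0 hvb hvb' ?_ c ?_
  · intro j
    by_cases hj : j = 3
    · simpa [a, b, hj] using hL
    · simp only [a, b, hj, if_false]; linarith
  · intro j
    by_cases hj : j = 3
    · simp only [hj, if_true]; fun_prop
    · simp only [hj, if_false]; fun_prop
  · intro j
    by_cases hj : j = 3
    · simp only [hj, if_true]; fun_prop
    · simp only [hj, if_false]; fun_prop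
  · intro j t
    by_cases hj : j = 3
    · simp only [hj, if_true]; exact hsh t
    · simp only [hj, if_false]; exact hcs _ t
  · intro j t
    by_cases hj : j = 3
    · simp only [hj, if_true]; exact hch t
    · simp only [hj, if_false]; exact hsn _ t
  · intro j t h1 h2
    by_cases hj : j = 3
    · simp only [a, b, hj, if_true] at h1 h2 ⊢
      exact Real.sinh_nonneg_iff.2 (mul_nonneg hk.le (by linarith))
    · simp only [a, b, hj, if_false] at h1 h2 ⊢
      exact Real.cos_nonneg_of_mem_Icc ⟨by linarith, by linarith⟩
  · intro j t h1 h2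
    by_cases hj : j = 3
    · simp only [a, b, hj, if_true] at h1 h2 ⊢
      exact Real.sinh_pos_iff.2 (mul_pos hk (by linarith))
    · simp only [a, b, hj, if_false] at h1 h2 ⊢
      exact Real.cos_pos_of_mem_Ioo ⟨by linarith, by linarith⟩
  · intro j
    by_cases hj : j = 3
    · simp [b, hj]
    · simp [b, hj]
  · intro j
    by_cases hj : j = 3
    · simp [b, hj, hk.le]
    · simp [b, hj]
  · intro j hj
    simp [a, hj, sub_sub_cancel_left]
  · intro j hj
    simp [a, hj, sub_sub_cancel_left]
  · intro x hx
    have hxI : x ∈ Set.Icc a b :=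
      ⟨fun i => (hx i trivial).1.le, fun i => (hx i trivial).2.le⟩
    have hx3 : 0 < x 3 := by simpa [a] using (hx 3 trivial).1
    refine (hle x hx3).trans (mul_le_mul_of_nonneg_right ?_ (hv0 x hx3.le))
    refine (hC' x hxI).trans ?_
    simp [Fin.sum_univ_four]
    linarith
  · intro j _
    by_cases hj : j = 3
    · subst hj
      simp [a, b, L, hc]
    · simp only [a, b, hj, if_false]
      constructor <;> linarith

lemma D_tang (i : Fin 4) (hi : i ≠ 3) (v : (Fin 4 → ℝ) → ℝ) (hv : ContDiff ℝ 2 v)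
    (hb : ∀ x, x 3 = 0 → v x = 0) (x : Fin 4 → ℝ) (hx : x 3 = 0) : D i v x = 0 := by
  have hd : DifferentiableAt ℝ v x := hv.differentiable (by norm_num) x
  have h1 := hd.hasFDerivAt.hasLineDerivAt (Pi.single i 1)
  have h2 : (fun t : ℝ => v (x + t • Pi.single i 1)) = fun _ => 0 := by
    funext t
    apply hb
    simp [hx, Pi.single_eq_of_ne hi.symm]
  unfold HasLineDerivAt at h1
  rw [h2] at h1
  exact h1.unique (hasDerivAt_const _ _)

lemma D_energy (v : (Fin 4 → ℝ) → ℝ) (hv : ContDiff ℝ 2 v) (x : Fin 4 → ℝ) :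
    D 3 (fun y => 1 / 2 * ∑ k, D k v y * D k v y) x = ∑ k, D k v x * D 3 (D k v) x := by
  have e : ∀ k, DifferentiableAt ℝ (D k v) x := fun k =>
    (D_contDiff k hv).differentiable (by norm_num) x
  have e2 : ∀ k, DifferentiableAt ℝ (fun y => D k v y * D k v y) x := fun k =>
    (e k).fun_mul (e k)
  simp only [Fin.sum_univ_four]
  rw [D_cmul 3 _ x ((((e2 0).fun_add (e2 1)).fun_add (e2 2)).fun_add (e2 3)),
    D_add 3 x (((e2 0).fun_add (e2 1)).fun_add (e2 2)) (e2 3),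
    D_add 3 x ((e2 0).fun_add (e2 1)) (e2 2), D_add 3 x (e2 0) (e2 1),
    D_mul 3 x (e 0) (e 0), D_mul 3 x (e 1) (e 1), D_mul 3 x (e 2) (e 2), D_mul 3 x (e 3) (e 3)]
  ring

/-- stress tensor, last row -/
noncomputable def F (v₁ v₂ W : (Fin 4 → ℝ) → ℝ) (i : Fin 4) (x : Fin 4 → ℝ) : ℝ :=
  (D 3 v₁ x * D i v₁ x + D 3 v₂ x * D i v₂ x) - (if i = 3 then (1 : ℝ) else 0) *
    ((1 / 2 * ∑ k, D k v₁ x * D k v₁ x) + (1 / 2 * ∑ k, D k v₂ x * D k v₂ x) + W x)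

lemma en_contDiff (v : (Fin 4 → ℝ) → ℝ) (hv : ContDiff ℝ 2 v) :
    ContDiff ℝ 1 (fun x => 1 / 2 * ∑ k, D k v x * D k v x) :=
  contDiff_const.mul (ContDiff.sum fun k _ => (D_contDiff k hv).mul (D_contDiff k hv))

lemma F_contDiff (v₁ v₂ W : (Fin 4 → ℝ) → ℝ) (hv₁ : ContDiff ℝ 2 v₁) (hv₂ : ContDiff ℝ 2 v₂)
    (hW : ContDiff ℝ 1 W) (i : Fin 4) : ContDiff ℝ 1 (F v₁ v₂ W i) := by
  unfold F
  exact (((D_contDiff 3 hv₁).mul (D_contDiff i hv₁)).add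
    ((D_contDiff 3 hv₂).mul (D_contDiff i hv₂))).sub (contDiff_const.mul
      (((en_contDiff v₁ hv₁).add (en_contDiff v₂ hv₂)).add hW))

lemma F_div (v₁ v₂ W : (Fin 4 → ℝ) → ℝ) (hv₁ : ContDiff ℝ 2 v₁) (hv₂ : ContDiff ℝ 2 v₂)
    (hW : ContDiff ℝ 1 W) (x : Fin 4 → ℝ)
    (hDW : D 3 W x = (∑ i, D i (D i v₁) x) * D 3 v₁ x + (∑ i, D i (D i v₂) x) * D 3 v₂ x) :
    ∑ i, D i (F v₁ v₂ W i) x = 0 := by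
  have hdf : ∀ {g : (Fin 4 → ℝ) → ℝ}, ContDiff ℝ 1 g → DifferentiableAt ℝ g x := fun h =>
    h.differentiable (by norm_num) x
  have e1 : ∀ k, DifferentiableAt ℝ (D k v₁) x := fun k => hdf (D_contDiff k hv₁)
  have e2 : ∀ k, DifferentiableAt ℝ (D k v₂) x := fun k => hdf (D_contDiff k hv₂)
  have n1 := hdf (en_contDiff v₁ hv₁)
  have n2 := hdf (en_contDiff v₂ hv₂)
  have n3 := hdf hW
  have hi : ∀ i, D i (F v₁ v₂ W i) x =
      (D 3 v₁ x * D i (D i v₁) x + D 3 (D i v₁) x * D i v₁ x) +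
      (D 3 v₂ x * D i (D i v₂) x + D 3 (D i v₂) x * D i v₂ x) -
      (if i = 3 then (1 : ℝ) else 0) * ((∑ k, D k v₁ x * D 3 (D k v₁) x)
        + (∑ k, D k v₂ x * D 3 (D k v₂) x) + D 3 W x) := by
    intro i
    have e0 := (n1.fun_add n2).fun_add n3
    unfold F
    rw [D_sub i x (((e1 3).fun_mul (e1 i)).fun_add ((e2 3).fun_mul (e2 i)))
      (e0.const_mul _), D_cmul i _ x e0,
      D_add i x ((e1 3).fun_mul (e1 i)) ((e2 3).fun_mul (e2 i)), D_mul i x (e1 3) (e1 i),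
      D_mul i x (e2 3) (e2 i), D_symm i 3 hv₁, D_symm i 3 hv₂]
    by_cases h3 : i = 3
    · subst h3
      rw [D_add 3 x (n1.fun_add n2) n3, D_add 3 x n1 n2, D_energy v₁ hv₁, D_energy v₂ hv₂]
    · simp [h3]
  simp only [hi, hDW]
  simp [Fin.sum_univ_four]
  ring

lemma F_bound (v₁ v₂ W : (Fin 4 → ℝ) → ℝ) (x : Fin 4 → ℝ) (M : ℝ)
    (h1 : ∀ i, (D i v₁ x) ^ 2 ≤ M) (h2 : ∀ i, (D i v₂ x) ^ 2 ≤ M) (hW : |W x| ≤ M) (i : Fin 4) :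
    |F v₁ v₂ W i x| ≤ 7 * M := by
  have hM : 0 ≤ M := (abs_nonneg _).trans hW
  have b1 : |D 3 v₁ x * D i v₁ x| ≤ M := by
    rw [abs_le]; constructor <;>
      nlinarith [h1 3, h1 i, sq_nonneg (D 3 v₁ x - D i v₁ x), sq_nonneg (D 3 v₁ x + D i v₁ x)]
  have b2 : |D 3 v₂ x * D i v₂ x| ≤ M := by
    rw [abs_le]; constructor <;>
      nlinarith [h2 3, h2 i, sq_nonneg (D 3 v₂ x - D i v₂ x), sq_nonneg (D 3 v₂ x + D i v₂ x)]
  have c1 : 0 ≤ ∑ k, D k v₁ x * D k v₁ x := Finset.sum_nonneg fun k _ => mul_self_nonneg _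
  have c2 : 0 ≤ ∑ k, D k v₂ x * D k v₂ x := Finset.sum_nonneg fun k _ => mul_self_nonneg _
  have d1 : ∑ k, D k v₁ x * D k v₁ x ≤ 4 * M := by
    simp only [Fin.sum_univ_four]
    linarith [h1 0, h1 1, h1 2, h1 3]
  have d2 : ∑ k, D k v₂ x * D k v₂ x ≤ 4 * M := by
    simp only [Fin.sum_univ_four]
    linarith [h2 0, h2 1, h2 2, h2 3]
  unfold F
  rw [abs_le] at *
  by_cases h3 : i = 3
  · simp only [h3, if_true] at *
    constructor <;> linarith
  · simp only [h3, if_false] at *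
    constructor <;> linarith

/-- cutoff factor -/
noncomputable def q (R : ℝ) : Fin 4 → ℝ → ℝ := fun _ t => 1 - t ^ 2 / R ^ 2

lemma q_deriv (R : ℝ) (j : Fin 4) (t : ℝ) : HasDerivAt (q R j) (-(2 * t / R ^ 2)) t := by
  unfold q
  convert! ((hasDerivAt_pow 2 t).div_const (R ^ 2)).const_sub 1 using 1
  simp

lemma q_nonneg (R : ℝ) (hR : 0 < R) (j : Fin 4) (t : ℝ) (ht : |t| ≤ R) : 0 ≤ q R j t := by
  unfold q
  rw [sub_nonneg, div_le_one (by positivity)]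
  exact sq_le_sq' (abs_le.1 ht).1 (abs_le.1 ht).2

lemma q_le (R : ℝ) (j : Fin 4) (t : ℝ) : q R j t ≤ 1 := by
  unfold q
  have : 0 ≤ t ^ 2 / R ^ 2 := by positivity
  linarith

lemma Pq_contDiff (R : ℝ) : ContDiff ℝ 1 (P (q R)) := by
  apply P_contDiff _ 1
  intro j
  unfold q
  fun_prop

lemma DPq (R : ℝ) (hR : 0 < R) (i : Fin 4) (x : Fin 4 → ℝ) (hx : ∀ j, |x j| ≤ R) :
    |D i (P (q R)) x| ≤ 2 / R := by
  rw [D_P i (q R) (fun t => -(2 * t / R ^ 2)) (fun j t => (q_deriv R j t).differentiableAt)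
    (q_deriv R i), P_update, abs_mul]
  have h1 : |∏ j ∈ Finset.univ.erase i, q R j (x j)| ≤ 1 := by
    rw [abs_of_nonneg (Finset.prod_nonneg fun j _ => q_nonneg R hR j _ (hx j))]
    exact Finset.prod_le_one (fun j _ => q_nonneg R hR j _ (hx j)) fun j _ => q_le R j _
  have h2 : |-(2 * x i / R ^ 2)| ≤ 2 / R := by
    rw [abs_neg, abs_div, abs_mul, abs_of_pos (show (0 : ℝ) < 2 by norm_num),
      abs_of_pos (show 0 < R ^ 2 by positivity), div_le_div_iff₀ (by positivity) hR]
    nlinarith [hx i]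
  calc _ ≤ 2 / R * 1 := mul_le_mul h2 h1 (abs_nonneg _) (by positivity)
    _ = _ := mul_one _

lemma step1_aux (v₁ v₂ W H : (Fin 4 → ℝ) → ℝ) (hv₁ : ContDiff ℝ 2 v₁) (hv₂ : ContDiff ℝ 2 v₂)
    (hW : ContDiff ℝ 1 W)
    (hDW : ∀ x, 0 < x 3 → D 3 W x =
      (∑ i, D i (D i v₁) x) * D 3 v₁ x + (∑ i, D i (D i v₂) x) * D 3 v₂ x)
    (hH : IntegrableOn H {x | 0 < x 3})
    (hH1 : ∀ i x, 0 < x 3 → (D i v₁ x) ^ 2 ≤ H x)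
    (hH2 : ∀ i x, 0 < x 3 → (D i v₂ x) ^ 2 ≤ H x)
    (hHW : ∀ x, 0 < x 3 → |W x| ≤ H x) (R : ℝ) (hR : 0 < R) :
    ∫ y in Set.Icc (fun _ : Fin 3 => -R) (fun _ => R),
      P (q R) (Fin.insertNth 3 0 y) * F v₁ v₂ W 3 (Fin.insertNth 3 0 y)
      ≤ 56 / R * ∫ x in {x : Fin 4 → ℝ | 0 < x 3}, H x := by
  let a : Fin 4 → ℝ := fun j => if j = 3 then 0 else -R
  let b : Fin 4 → ℝ := fun _ => R
  have hab : a ≤ b := by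
    intro j
    by_cases hj : j = 3 <;> simp [a, b, hj] <;> linarith
  let f : Fin 4 → (Fin 4 → ℝ) → ℝ := fun i x => P (q R) x * F v₁ v₂ W i x
  have hFs := F_contDiff v₁ v₂ W hv₁ hv₂ hW
  have hf : ∀ i, ContDiff ℝ 1 (f i) := fun i => (Pq_contDiff R).mul (hFs i)
  have hmain := diverg a b hab f hf
  have hP0 : ∀ i (z : Fin 4 → ℝ), |z i| = R → P (q R) z = 0 := by
    intro i z hz
    apply Finset.prod_eq_zero (Finset.mem_univ i)
    unfold q
    rw [← sq_abs, hz, div_self (by positivity), sub_self]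
  have hfr : ∀ i (y : Fin 3 → ℝ), f i (i.insertNth (b i) y) = 0 := by
    intro i y
    show P (q R) _ * _ = 0
    rw [hP0 i _ (by simp [b, hR.le]), zero_mul]
  have hbk : ∀ i, i ≠ 3 → ∀ (y : Fin 3 → ℝ), f i (i.insertNth (a i) y) = 0 := by
    intro i hi y
    show P (q R) _ * _ = 0
    rw [hP0 i _ (by simp [a, hi, hR.le]), zero_mul]
  rw [Finset.sum_eq_single 3] at hmain
  rotate_left
  · intro i _ hi
    simp only [hfr, hbk i hi, sub_self]
  · simp
  simp only [hfr, integral_zero, zero_sub] at hmain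
  have ha3 : a 3 = 0 := by simp [a]
  have hac : a ∘ (3 : Fin 4).succAbove = fun _ => -R := by
    funext j
    have : (3 : Fin 4).succAbove j ≠ 3 := Fin.succAbove_ne _ _
    simp [a, this]
  have hbc : b ∘ (3 : Fin 4).succAbove = fun _ => R := rfl
  rw [ha3, hac, hbc] at hmain
  set B := Set.pi Set.univ (fun i => Set.Ioo (a i) (b i)) with hB
  have hBo : IsOpen B := isOpen_set_pi Set.finite_univ fun i _ => isOpen_Ioo
  have hB3 : B ⊆ {x | 0 < x 3} := fun x hx => by simpa [a] using (hx 3 trivial).1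
  have hBR : ∀ x ∈ B, ∀ j, |x j| ≤ R := by
    intro x hx j
    have h := hx j trivial
    rw [abs_le]
    refine ⟨?_, h.2.le⟩
    by_cases hj : j = 3
    · have := h.1
      simp only [a, hj, if_true] at this ⊢
      linarith
    · have := h.1
      simp only [a, hj, if_false] at this
      linarith
  have hbd : ∀ x ∈ B, ‖∑ i, D i (f i) x‖ ≤ 56 / R * H x := by
    intro x hx
    have hx3 : 0 < x 3 := hB3 hx
    have h1 : ∑ i, D i (f i) x = ∑ i, D i (P (q R)) x * F v₁ v₂ W i x := by
      have : ∀ i, D i (f i) x = P (q R) x * D i (F v₁ v₂ W i) x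
          + D i (P (q R)) x * F v₁ v₂ W i x := fun i =>
        D_mul i x ((Pq_contDiff R).differentiable (by norm_num) x)
          ((hFs i).differentiable (by norm_num) x)
      simp only [this]
      rw [Finset.sum_add_distrib, ← Finset.mul_sum,
        F_div v₁ v₂ W hv₁ hv₂ hW x (hDW x hx3), mul_zero, zero_add]
    rw [h1]
    refine (norm_sum_le _ _).trans ?_
    have h2 : ∀ i ∈ Finset.univ, ‖D i (P (q R)) x * F v₁ v₂ W i x‖ ≤ 2 / R * (7 * H x) := by
      intro i _
      rw [norm_mul]
      exact mul_le_mul (DPq R hR i x (hBR x hx)) (F_bound v₁ v₂ W x (H x) (fun i => hH1 i x hx3)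
        (fun i => hH2 i x hx3) (hHW x hx3) i) (norm_nonneg _) (by positivity)
    refine (Finset.sum_le_sum h2).trans (le_of_eq ?_)
    simp
    ring
  have hH0 : 0 ≤ᵐ[volume.restrict {x : Fin 4 → ℝ | 0 < x 3}] H := by
    have hm : MeasurableSet {x : Fin 4 → ℝ | 0 < x 3} :=
      (isOpen_lt continuous_const (continuous_apply 3)).measurableSet
    filter_upwards [ae_restrict_mem hm] with x hx using (sq_nonneg _).trans (hH1 0 x hx)
  have hHB : IntegrableOn (fun x => 56 / R * H x) B := (hH.mono_set hB3).const_mul _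
  have h3 : ‖∫ x in B, ∑ i, D i (f i) x‖ ≤ ∫ x in B, 56 / R * H x := by
    apply norm_integral_le_of_norm_le hHB
    filter_upwards [ae_restrict_mem hBo.measurableSet] with x hx using hbd x hx
  rw [hmain, norm_neg] at h3
  rw [integral_const_mul] at h3
  have h4 : ∫ x in B, H x ≤ ∫ x in {x : Fin 4 → ℝ | 0 < x 3}, H x :=
    setIntegral_mono_set hH hH0 hB3.eventuallyLE
  have h5 := mul_le_mul_of_nonneg_left h4 (show 0 ≤ 56 / R by positivity)
  exact (le_abs_self _).trans (h3.trans h5)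

lemma step1 (v₁ v₂ W H : (Fin 4 → ℝ) → ℝ) (hv₁ : ContDiff ℝ 2 v₁) (hv₂ : ContDiff ℝ 2 v₂)
    (hW : ContDiff ℝ 1 W)
    (hb₁ : ∀ x, x 3 = 0 → v₁ x = 0) (hb₂ : ∀ x, x 3 = 0 → v₂ x = 0)
    (hWb : ∀ x, x 3 = 0 → W x = 0)
    (hDW : ∀ x, 0 < x 3 → D 3 W x =
      (∑ i, D i (D i v₁) x) * D 3 v₁ x + (∑ i, D i (D i v₂) x) * D 3 v₂ x)
    (hH : IntegrableOn H {x | 0 < x 3})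
    (hH1 : ∀ i x, 0 < x 3 → (D i v₁ x) ^ 2 ≤ H x)
    (hH2 : ∀ i x, 0 < x 3 → (D i v₂ x) ^ 2 ≤ H x)
    (hHW : ∀ x, 0 < x 3 → |W x| ≤ H x) :
    ∀ x, x 3 = 0 → D 3 v₁ x = 0 ∧ D 3 v₂ x = 0 := by
  intro x₀ hx₀
  let g : (Fin 4 → ℝ) → ℝ := fun x => 1 / 2 * ((D 3 v₁ x) ^ 2 + (D 3 v₂ x) ^ 2)
  have hg0 : ∀ x, 0 ≤ g x := fun x => by positivity
  have hFg : ∀ x, x 3 = 0 → F v₁ v₂ W 3 x = g x := by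
    intro x hx
    simp only [F, g, Fin.sum_univ_four, if_true, hWb x hx, D_tang 0 (by decide) v₁ hv₁ hb₁ x hx,
      D_tang 1 (by decide) v₁ hv₁ hb₁ x hx, D_tang 2 (by decide) v₁ hv₁ hb₁ x hx,
      D_tang 0 (by decide) v₂ hv₂ hb₂ x hx,
      D_tang 1 (by decide) v₂ hv₂ hb₂ x hx, D_tang 2 (by decide) v₂ hv₂ hb₂ x hx]
    ring
  have hgc : Continuous g := continuous_const.mul
    (((D_contDiff 3 hv₁).continuous.pow 2).add ((D_contDiff 3 hv₂).continuous.pow 2))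
  have hins : Continuous (fun y : Fin 3 → ℝ => (Fin.insertNth 3 (0 : ℝ) y : Fin 4 → ℝ)) :=
    Continuous.finInsertNth 3 continuous_const continuous_id
  let G : (Fin 3 → ℝ) → ℝ := fun y => g (Fin.insertNth 3 (0 : ℝ) y : Fin 4 → ℝ)
  have hGc : Continuous G := hgc.comp hins
  let R₀ : ℝ := ‖x₀‖ + 1
  have hR₀ : 0 < R₀ := by positivity
  let U : Set (Fin 3 → ℝ) := Set.pi Set.univ (fun _ => Set.Ioo (-R₀) R₀)
  have hUo : IsOpen U := isOpen_set_pi Set.finite_univ fun i _ => isOpen_Ioo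
  have hUi : IntegrableOn G U := box_int (fun _ => -R₀) (fun _ => R₀) G hGc
  set I := ∫ x in {x : Fin 4 → ℝ | 0 < x 3}, H x with hI
  have hbound : ∀ R, 2 * R₀ ≤ R → ∫ y in U, G y ≤ 224 * I / R := by
    intro R hR
    have hRp : 0 < R := by linarith
    have h1 := step1_aux v₁ v₂ W H hv₁ hv₂ hW hDW hH hH1 hH2 hHW R hRp
    have hsub : U ⊆ Set.Icc (fun _ : Fin 3 => -R) (fun _ => R) := by
      intro y hy
      constructor
      · intro j; have := (hy j trivial).1; show -R ≤ y j; linarith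
      · intro j; have := (hy j trivial).2; show y j ≤ R; linarith
    let K : (Fin 3 → ℝ) → ℝ := fun y =>
      P (q R) (Fin.insertNth 3 0 y) * F v₁ v₂ W 3 (Fin.insertNth 3 0 y)
    have hKc : Continuous K := ((Pq_contDiff R).continuous.comp hins).mul
      ((F_contDiff v₁ v₂ W hv₁ hv₂ hW 3).continuous.comp hins)
    have hKi : IntegrableOn K (Set.Icc (fun _ : Fin 3 => -R) (fun _ => R)) :=
      hKc.continuousOn.integrableOn_compact isCompact_Icc
    have hKG : ∀ y, K y = P (q R) (Fin.insertNth 3 0 y) * G y := by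
      intro y
      show _ * _ = _ * _
      rw [hFg _ (by simp)]
    have habs : ∀ (r : ℝ) (y : Fin 3 → ℝ), 0 ≤ r → (∀ j, |y j| ≤ r) →
        ∀ j, |(Fin.insertNth 3 (0 : ℝ) y : Fin 4 → ℝ) j| ≤ r := by
      intro r y hr hy j
      rcases Fin.eq_self_or_eq_succAbove 3 j with h | ⟨k, h⟩
      · rw [h]; simpa using hr
      · rw [h, Fin.insertNth_apply_succAbove]; exact hy k
    have hK0 : 0 ≤ᵐ[volume.restrict (Set.Icc (fun _ : Fin 3 => -R) (fun _ => R))] K := by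
      filter_upwards [ae_restrict_mem measurableSet_Icc] with y hy
      rw [hKG]
      refine mul_nonneg (P_nonneg _ _ fun j => q_nonneg R hRp j _ ?_) (hg0 _)
      exact habs R y hRp.le (fun j => abs_le.2 ⟨hy.1 j, hy.2 j⟩) j
    have h2 : ∫ y in U, K y ≤ ∫ y in Set.Icc (fun _ : Fin 3 => -R) (fun _ => R), K y :=
      setIntegral_mono_set hKi hK0 hsub.eventuallyLE
    have h3 : ∫ y in U, 1 / 4 * G y ≤ ∫ y in U, K y := by
      apply setIntegral_mono_on (hUi.const_mul _) (hKi.mono_set hsub) hUo.measurableSet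
      intro y hy
      rw [hKG]
      refine mul_le_mul_of_nonneg_right ?_ (hg0 _)
      have hq : ∀ j ∈ Finset.univ, (3 / 4 : ℝ) ≤ q R j ((Fin.insertNth 3 (0 : ℝ) y : Fin 4 → ℝ) j) := by
        intro j _
        have h := habs R₀ y hR₀.le (fun j => abs_le.2 ⟨(hy j trivial).1.le, (hy j trivial).2.le⟩) j
        generalize (Fin.insertNth 3 (0 : ℝ) y : Fin 4 → ℝ) j = t at h
        unfold q
        have : t ^ 2 / R ^ 2 ≤ 1 / 4 := by
          rw [div_le_div_iff₀ (by positivity) (by norm_num), ← sq_abs]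
          nlinarith [abs_nonneg t]
        linarith
      have := Finset.prod_le_prod (fun j _ => by norm_num) hq
      simp only [Finset.prod_const] at this
      refine le_trans ?_ this
      simp
      norm_num
    rw [integral_const_mul] at h3
    have h4 := h3.trans (h2.trans h1)
    have : 224 * I / R = 4 * (56 / R * I) := by ring
    rw [this]
    linarith
  have hle : ∫ y in U, G y ≤ 0 := by
    have ht : Tendsto (fun R : ℝ => 224 * I / R) atTop (nhds 0) :=
      tendsto_const_nhds.div_atTop tendsto_id
    exact ge_of_tendsto ht ((eventually_ge_atTop (2 * R₀)).mono hbound)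
  have hz := zero_of_int U hUo G hGc hUi (fun y _ => hg0 _) hle
    (Fin.removeNth 3 x₀) (by
      intro j _
      have : |x₀ ((3 : Fin 4).succAbove j)| ≤ ‖x₀‖ := norm_le_pi_norm x₀ _
      have h2 := abs_le.1 this
      simp only [Fin.removeNth, R₀]
      constructor <;> linarith)
  have hz' : g x₀ = 0 := by
    have : (Fin.insertNth 3 (0 : ℝ) (Fin.removeNth 3 x₀) : Fin 4 → ℝ) = x₀ := by
      rw [← hx₀]; exact Fin.insertNth_self_removeNth 3 x₀
    simpa only [G, this] using hz
  simp only [g] at hz'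
  constructor <;> nlinarith [sq_nonneg (D 3 v₁ x₀), sq_nonneg (D 3 v₂ x₀)]

lemma D_toLp (i : Fin 4) (u : EuclideanSpace ℝ (Fin 4) → ℝ) (x : Fin 4 → ℝ) :
    D i (fun y => u (WithLp.toLp 2 y)) x
      = fderiv ℝ u (WithLp.toLp 2 x) (EuclideanSpace.single i 1) := by
  let e := (EuclideanSpace.equiv (Fin 4) ℝ).symm
  have h : fderiv ℝ (u ∘ e) x = (fderiv ℝ u (e x)).comp (e : (Fin 4 → ℝ) →L[ℝ] _) :=
    e.comp_right_fderiv
  show fderiv ℝ (u ∘ e) x (Pi.single i 1) = _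
  rw [h]
  rfl

lemma lap_toLp (u : EuclideanSpace ℝ (Fin 4) → ℝ) (x : Fin 4 → ℝ) :
    lap4 u (WithLp.toLp 2 x) = ∑ i, D i (D i (fun y => u (WithLp.toLp 2 y))) x := by
  unfold lap4
  apply Finset.sum_congr rfl
  intro i _
  have : D i (fun y => u (WithLp.toLp 2 y)) =
      fun y => (fun z => fderiv ℝ u z (EuclideanSpace.single i 1)) (WithLp.toLp 2 y) := by
    funext y; exact D_toLp i u y
  rw [this]
  exact (D_toLp i (fun z => fderiv ℝ u z (EuclideanSpace.single i 1)) x).symm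

lemma D_le (i : Fin 4) (u : EuclideanSpace ℝ (Fin 4) → ℝ) (x : Fin 4 → ℝ) :
    (D i (fun y => u (WithLp.toLp 2 y)) x) ^ 2 ≤ ‖fderiv ℝ u (WithLp.toLp 2 x)‖ ^ 2 := by
  rw [D_toLp]
  have := (fderiv ℝ u (WithLp.toLp 2 x)).le_opNorm (EuclideanSpace.single i 1)
  have h1 : ‖(EuclideanSpace.single i 1 : EuclideanSpace ℝ (Fin 4))‖ = 1 := by simp
  rw [h1, mul_one, Real.norm_eq_abs] at this
  exact sq_le_sq.2 (by rwa [abs_of_nonneg (norm_nonneg (fderiv ℝ u (WithLp.toLp 2 x)))])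

lemma bdd (u : EuclideanSpace ℝ (Fin 4) → ℝ) (hu : ContDiff ℝ 2 u)
    (hdecay : Tendsto (fun x => u x + ‖fderiv ℝ u x‖)
      (cocompact (EuclideanSpace ℝ (Fin 4))) (nhds 0)) : ∃ M, 0 < M ∧ ∀ x, u x ≤ M := by
  have h1 : ∀ᶠ x in cocompact (EuclideanSpace ℝ (Fin 4)), u x + ‖fderiv ℝ u x‖ < 1 :=
    hdecay.eventually (gt_mem_nhds one_pos)
  obtain ⟨K, hK, hsub⟩ := mem_cocompact.1 h1
  obtain ⟨C, hC⟩ := hK.bddAbove_image hu.continuous.continuousOn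
  refine ⟨max C 1, by positivity, fun x => ?_⟩
  by_cases hx : x ∈ K
  · exact (hC ⟨x, hx, rfl⟩).trans (le_max_left _ _)
  · have : u x + ‖fderiv ℝ u x‖ < 1 := hsub hx
    have := norm_nonneg (fderiv ℝ u x)
    exact le_trans (by linarith) (le_max_right _ _)

lemma int_toLp (N : EuclideanSpace ℝ (Fin 4) → ℝ)
    (h : IntegrableOn N {x : EuclideanSpace ℝ (Fin 4) | 0 < x 3}) :
    IntegrableOn (fun x : Fin 4 → ℝ => N (WithLp.toLp 2 x)) {x | 0 < x 3} :=
  ((PiLp.volume_preserving_toLp (Fin 4)).integrableOn_comp_preimage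
    (MeasurableEquiv.toLp 2 _).measurableEmbedding).2 h

/-- single potential -/
noncomputable def pot (l μ α p t : ℝ) : ℝ := l / 2 * t ^ 2 - μ / 4 * t ^ 4 - α / p * t ^ p

lemma pot_deriv (l μ α p t : ℝ) (hp : 2 < p) :
    HasDerivAt (pot l μ α p) (l * t - μ * t ^ 3 - α * t ^ (p - 1)) t := by
  unfold pot
  have h1 := (hasDerivAt_pow 2 t).const_mul (l / 2)
  have h2 := (hasDerivAt_pow 4 t).const_mul (μ / 4)
  have h3 := (Real.hasDerivAt_rpow_const (x := t) (p := p) (Or.inr (by linarith))).const_mul (α / p)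
  convert! (h1.sub h2).sub h3 using 1
  have : p ≠ 0 := by linarith
  field_simp
  push_cast
  ring

lemma pot_contDiff (l μ α p : ℝ) (hp : 2 < p) : ContDiff ℝ 1 (pot l μ α p) := by
  unfold pot
  have h : ContDiff ℝ ((1 : ℕ) : WithTop ℕ∞) fun x : ℝ => x ^ p :=
    Real.contDiff_rpow_const_of_le (by push_cast; linarith)
  have h' : ContDiff ℝ 1 fun x : ℝ => x ^ p := by exact_mod_cast h
  exact ((contDiff_const.mul (contDiff_id.pow 2)).sub
    (contDiff_const.mul (contDiff_id.pow 4))).sub (contDiff_const.mul h')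

lemma pot_bound (l μ α p M t : ℝ) (hl : 0 < l) (hμ : 0 < μ) (hα : 0 < α) (hp : 2 < p)
    (h0 : 0 ≤ t) (hM : t ≤ M) :
    |pot l μ α p t| ≤ (l / 2 + μ / 4 * M ^ 2 + α / p * M ^ (p - 2)) * t ^ 2 := by
  have e : t ^ p = t ^ (p - 2) * t ^ 2 := by
    rw [← Real.rpow_two, ← Real.rpow_add_of_nonneg h0 (by linarith) (by norm_num)]
    congr 1; ring
  have e1 : t ^ (p - 2) ≤ M ^ (p - 2) := Real.rpow_le_rpow h0 hM (by linarith)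
  have e2 : 0 ≤ t ^ (p - 2) := Real.rpow_nonneg h0 _
  have e3 : t ^ 2 ≤ M ^ 2 := pow_le_pow_left₀ h0 hM 2
  have hap : 0 ≤ α / p := by apply div_nonneg <;> linarith
  have a1 : 0 ≤ l / 2 * t ^ 2 := by positivity
  have a2 : 0 ≤ μ / 4 * (t ^ 2 * t ^ 2) := by positivity
  have a3 : 0 ≤ α / p * (t ^ (p - 2) * t ^ 2) := by positivity
  have b2 : μ / 4 * (t ^ 2 * t ^ 2) ≤ μ / 4 * (M ^ 2 * t ^ 2) := by gcongr
  have b3 : α / p * (t ^ (p - 2) * t ^ 2) ≤ α / p * (M ^ (p - 2) * t ^ 2) := by gcongr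
  unfold pot
  rw [e, show t ^ 4 = t ^ 2 * t ^ 2 by ring, abs_le]
  constructor <;> nlinarith

end HS

open HS

/-- nonnegative `C² ∩ H¹` solutions of the coupled system on the half-space
ℝ⁴₊ = {x₄ > 0}, vanishing on the boundary and decaying (together with their gradients)
at infinity, are identically zero. -/
theorem stmt_6 (l₁ l₂ μ₁ μ₂ α₁ α₂ β p : ℝ)
    (hl₁ : 0 < l₁) (hl₂ : 0 < l₂) (hμ₁ : 0 < μ₁) (hμ₂ : 0 < μ₂)
    (hα₁ : 0 < α₁) (hα₂ : 0 < α₂) (hβ : β ≠ 0) (hp : 2 < p) (hp' : p < 4)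
    (u₁ u₂ : EuclideanSpace ℝ (Fin 4) → ℝ)
    (hreg₁ : ContDiff ℝ 2 u₁) (hreg₂ : ContDiff ℝ 2 u₂)
    (hnonneg : ∀ x, 0 ≤ x 3 → 0 ≤ u₁ x ∧ 0 ≤ u₂ x)
    (hbdry : ∀ x, x 3 = 0 → u₁ x = 0 ∧ u₂ x = 0)
    (hH1₁ : IntegrableOn (fun x => ‖fderiv ℝ u₁ x‖ ^ 2 + (u₁ x) ^ 2)
      {x : EuclideanSpace ℝ (Fin 4) | 0 < x 3})
    (hH1₂ : IntegrableOn (fun x => ‖fderiv ℝ u₂ x‖ ^ 2 + (u₂ x) ^ 2)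
      {x : EuclideanSpace ℝ (Fin 4) | 0 < x 3})
    (hdecay₁ : Tendsto (fun x => u₁ x + ‖fderiv ℝ u₁ x‖)
      (cocompact (EuclideanSpace ℝ (Fin 4))) (nhds 0))
    (hdecay₂ : Tendsto (fun x => u₂ x + ‖fderiv ℝ u₂ x‖)
      (cocompact (EuclideanSpace ℝ (Fin 4))) (nhds 0))
    (heq₁ : ∀ x, 0 < x 3 →
      -lap4 u₁ x + l₁ * u₁ x =
        μ₁ * (u₁ x) ^ 3 + α₁ * (u₁ x) ^ (p - 1) + β * (u₂ x) ^ 2 * u₁ x)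
    (heq₂ : ∀ x, 0 < x 3 →
      -lap4 u₂ x + l₂ * u₂ x =
        μ₂ * (u₂ x) ^ 3 + α₂ * (u₂ x) ^ (p - 1) + β * (u₁ x) ^ 2 * u₂ x) :
    ∀ x, 0 ≤ x 3 → u₁ x = 0 ∧ u₂ x = 0 := by
  let v₁ : (Fin 4 → ℝ) → ℝ := fun x => u₁ (WithLp.toLp 2 x)
  let v₂ : (Fin 4 → ℝ) → ℝ := fun x => u₂ (WithLp.toLp 2 x)
  have hcd : ContDiff ℝ 2 (fun x : Fin 4 → ℝ => (WithLp.toLp 2 x : EuclideanSpace ℝ (Fin 4))) :=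
    (EuclideanSpace.equiv (Fin 4) ℝ).symm.contDiff
  have hv₁ : ContDiff ℝ 2 v₁ := hreg₁.comp hcd
  have hv₂ : ContDiff ℝ 2 v₂ := hreg₂.comp hcd
  have hv₁' : ContDiff ℝ 1 v₁ := hv₁.of_le (by norm_num)
  have hv₂' : ContDiff ℝ 1 v₂ := hv₂.of_le (by norm_num)
  have hn₁ : ∀ x : Fin 4 → ℝ, 0 ≤ x 3 → 0 ≤ v₁ x := fun x hx => (hnonneg (WithLp.toLp 2 x) hx).1
  have hn₂ : ∀ x : Fin 4 → ℝ, 0 ≤ x 3 → 0 ≤ v₂ x := fun x hx => (hnonneg (WithLp.toLp 2 x) hx).2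
  have hb₁ : ∀ x : Fin 4 → ℝ, x 3 = 0 → v₁ x = 0 := fun x hx => (hbdry (WithLp.toLp 2 x) hx).1
  have hb₂ : ∀ x : Fin 4 → ℝ, x 3 = 0 → v₂ x = 0 := fun x hx => (hbdry (WithLp.toLp 2 x) hx).2
  have hE₁ : ∀ x : Fin 4 → ℝ, 0 < x 3 → ∑ i, D i (D i v₁) x =
      l₁ * v₁ x - μ₁ * v₁ x ^ 3 - α₁ * v₁ x ^ (p - 1) - β * v₂ x ^ 2 * v₁ x := by
    intro x hx
    have := heq₁ (WithLp.toLp 2 x) hx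
    rw [lap_toLp] at this
    simp only [v₁, v₂]
    linarith
  have hE₂ : ∀ x : Fin 4 → ℝ, 0 < x 3 → ∑ i, D i (D i v₂) x =
      l₂ * v₂ x - μ₂ * v₂ x ^ 3 - α₂ * v₂ x ^ (p - 1) - β * v₁ x ^ 2 * v₂ x := by
    intro x hx
    have := heq₂ (WithLp.toLp 2 x) hx
    rw [lap_toLp] at this
    simp only [v₁, v₂]
    linarith
  obtain ⟨M₁, hM₁, hu₁⟩ := bdd u₁ hreg₁ hdecay₁
  obtain ⟨M₂, hM₂, hu₂⟩ := bdd u₂ hreg₂ hdecay₂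
  let W : (Fin 4 → ℝ) → ℝ := fun x => (pot l₁ μ₁ α₁ p (v₁ x) + pot l₂ μ₂ α₂ p (v₂ x))
    - β / 2 * ((v₁ x * v₁ x) * (v₂ x * v₂ x))
  have hp1 : ContDiff ℝ 1 (fun x => pot l₁ μ₁ α₁ p (v₁ x)) := (pot_contDiff l₁ μ₁ α₁ p hp).comp hv₁'
  have hp2 : ContDiff ℝ 1 (fun x => pot l₂ μ₂ α₂ p (v₂ x)) := (pot_contDiff l₂ μ₂ α₂ p hp).comp hv₂'
  have hp3 : ContDiff ℝ 1 (fun x => (v₁ x * v₁ x) * (v₂ x * v₂ x)) :=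
    (hv₁'.mul hv₁').mul (hv₂'.mul hv₂')
  have hW : ContDiff ℝ 1 W := (hp1.add hp2).sub (contDiff_const.mul hp3)
  let C₁ : ℝ := l₁ / 2 + μ₁ / 4 * M₁ ^ 2 + α₁ / p * M₁ ^ (p - 2)
  let C₂ : ℝ := l₂ / 2 + μ₂ / 4 * M₂ ^ 2 + α₂ / p * M₂ ^ (p - 2)
  let C₃ : ℝ := |β| / 2 * M₂ ^ 2
  have hp0 : 0 < p := by linarith
  have hC₁ : 0 ≤ C₁ := by positivity
  have hC₂ : 0 ≤ C₂ := by positivity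
  have hC₃ : 0 ≤ C₃ := by positivity
  let K : ℝ := 1 + C₁ + C₂ + C₃
  let N₁ : (Fin 4 → ℝ) → ℝ := fun x => ‖fderiv ℝ u₁ (WithLp.toLp 2 x)‖ ^ 2 + v₁ x ^ 2
  let N₂ : (Fin 4 → ℝ) → ℝ := fun x => ‖fderiv ℝ u₂ (WithLp.toLp 2 x)‖ ^ 2 + v₂ x ^ 2
  have hN₁ : ∀ x, 0 ≤ N₁ x := fun x => by positivity
  have hN₂ : ∀ x, 0 ≤ N₂ x := fun x => by positivity
  let H : (Fin 4 → ℝ) → ℝ := fun x => K * (N₁ x + N₂ x)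
  have hK1 : 1 ≤ K := by simp only [K]; linarith
  have hH : IntegrableOn H {x | 0 < x 3} :=
    ((int_toLp _ hH1₁).add (int_toLp _ hH1₂)).const_mul K
  have hHge : ∀ x, N₁ x + N₂ x ≤ H x := fun x => by
    have := mul_le_mul_of_nonneg_right hK1 (add_nonneg (hN₁ x) (hN₂ x))
    simpa [H] using this
  have hst := step1 v₁ v₂ W H hv₁ hv₂ hW hb₁ hb₂
    (by
      intro x hx
      have : (0 : ℝ) ^ p = 0 := Real.zero_rpow hp0.ne'
      simp [W, pot, hb₁ x hx, hb₂ x hx, this])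
    (by
      intro x hx
      have d1 : DifferentiableAt ℝ v₁ x := hv₁'.differentiable (by norm_num) x
      have d2 : DifferentiableAt ℝ v₂ x := hv₂'.differentiable (by norm_num) x
      have q1 := hp1.differentiable (by norm_num) x
      have q2 := hp2.differentiable (by norm_num) x
      have q3 := hp3.differentiable (by norm_num) x
      rw [hE₁ x hx, hE₂ x hx]
      simp only [W]
      rw [D_sub 3 x (q1.fun_add q2) (q3.const_mul _), D_add 3 x q1 q2, D_cmul 3 _ x q3,
        D_mul 3 x (d1.fun_mul d1) (d2.fun_mul d2), D_mul 3 x d1 d1, D_mul 3 x d2 d2,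
        D_comp 3 x d1 (pot_deriv l₁ μ₁ α₁ p _ hp), D_comp 3 x d2 (pot_deriv l₂ μ₂ α₂ p _ hp)]
      ring)
    hH
    (by
      intro i x _
      have h1 := D_le i u₁ x
      have h2 := hHge x
      have h3 := hN₂ x
      have h4 := sq_nonneg (v₁ x)
      have h5 : N₁ x = ‖fderiv ℝ u₁ (WithLp.toLp 2 x)‖ ^ 2 + v₁ x ^ 2 := rfl
      exact h1.trans (by linarith))
    (by
      intro i x _
      have h1 := D_le i u₂ x
      have h2 := hHge x
      have h3 := hN₁ x
      have h4 := sq_nonneg (v₂ x)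
      have h5 : N₂ x = ‖fderiv ℝ u₂ (WithLp.toLp 2 x)‖ ^ 2 + v₂ x ^ 2 := rfl
      exact h1.trans (by linarith))
    (by
      intro x hx
      have b1 := pot_bound l₁ μ₁ α₁ p M₁ (v₁ x) hl₁ hμ₁ hα₁ hp (hn₁ x hx.le) (hu₁ _)
      have b2 := pot_bound l₂ μ₂ α₂ p M₂ (v₂ x) hl₂ hμ₂ hα₂ hp (hn₂ x hx.le) (hu₂ _)
      have b3 : |β / 2 * ((v₁ x * v₁ x) * (v₂ x * v₂ x))| ≤ C₃ * v₁ x ^ 2 := by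
        have e3 : v₂ x ^ 2 ≤ M₂ ^ 2 := pow_le_pow_left₀ (hn₂ x hx.le) (hu₂ _) 2
        have : (v₁ x * v₁ x) * (v₂ x * v₂ x) = v₁ x ^ 2 * v₂ x ^ 2 := by ring
        rw [this, abs_mul, abs_div, abs_of_pos (show (0 : ℝ) < 2 by norm_num),
          abs_of_nonneg (show 0 ≤ v₁ x ^ 2 * v₂ x ^ 2 by positivity)]
        calc |β| / 2 * (v₁ x ^ 2 * v₂ x ^ 2) ≤ |β| / 2 * (v₁ x ^ 2 * M₂ ^ 2) := by gcongr
          _ = C₃ * v₁ x ^ 2 := by simp only [C₃]; ring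
      have t1 : v₁ x ^ 2 ≤ N₁ x + N₂ x := by
        have := hN₂ x
        have h4 := sq_nonneg (‖fderiv ℝ u₁ (WithLp.toLp 2 x)‖)
        have h5 : N₁ x = ‖fderiv ℝ u₁ (WithLp.toLp 2 x)‖ ^ 2 + v₁ x ^ 2 := rfl
        linarith
      have t2 : v₂ x ^ 2 ≤ N₁ x + N₂ x := by
        have := hN₁ x
        have h4 := sq_nonneg (‖fderiv ℝ u₂ (WithLp.toLp 2 x)‖)
        have h5 : N₂ x = ‖fderiv ℝ u₂ (WithLp.toLp 2 x)‖ ^ 2 + v₂ x ^ 2 := rfl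
        linarith
      have s1 := mul_le_mul_of_nonneg_left t1 hC₁
      have s2 := mul_le_mul_of_nonneg_left t2 hC₂
      have s3 := mul_le_mul_of_nonneg_left t1 hC₃
      have s0 := add_nonneg (hN₁ x) (hN₂ x)
      have hHx : H x = (N₁ x + N₂ x) + C₁ * (N₁ x + N₂ x) + C₂ * (N₁ x + N₂ x)
        + C₃ * (N₁ x + N₂ x) := by simp only [H, K]; ring
      refine (abs_sub _ _).trans ?_
      have := abs_add_le (pot l₁ μ₁ α₁ p (v₁ x)) (pot l₂ μ₂ α₂ p (v₂ x))
      change _ ≤ C₁ * _ at b1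
      change _ ≤ C₂ * _ at b2
      linarith)
  have hz₁ := step2 v₁ (fun x => l₁ - β * v₂ x ^ 2) hv₁
    (continuous_const.sub (continuous_const.mul (hv₂.continuous.pow 2))) hn₁ hb₁
    (fun x hx => (hst x hx).1) (by
      intro x hx
      rw [hE₁ x hx]
      have h0 := hn₁ x hx.le
      have a1 : 0 ≤ μ₁ * v₁ x ^ 3 := by positivity
      have a2 : 0 ≤ α₁ * v₁ x ^ (p - 1) := by positivity
      linarith)
  have hz₂ := step2 v₂ (fun x => l₂ - β * v₁ x ^ 2) hv₂
    (continuous_const.sub (continuous_const.mul (hv₁.continuous.pow 2))) hn₂ hb₂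
    (fun x hx => (hst x hx).2) (by
      intro x hx
      rw [hE₂ x hx]
      have h0 := hn₂ x hx.le
      have a1 : 0 ≤ μ₂ * v₂ x ^ 3 := by positivity
      have a2 : 0 ≤ α₂ * v₂ x ^ (p - 1) := by positivity
      linarith)
  intro x hx
  rcases hx.eq_or_lt with h | h
  · exact hbdry x h.symm
  · exact ⟨hz₁ (WithLp.ofLp x) h, hz₂ (WithLp.ofLp x) h⟩
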